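/- Let Q be an AIM loop and let a be an element of the nucleus N(Q). Then for all x, y in Q, the elements T(a,x), L(a,x,y) and R(a,x,y) also lie in N(Q). Consequently, the nucleus of an AIM loop is a normal subloop. -/

import Mathlib

/-- A loop: a set with multiplication, left division, right division and identity. -/
structure LoopStr (Q : Type*) where
  mul : Q → Q → Q
  ld : Q → Q → Q
  rd : Q → Q → Q
  one : Q
  one_mul : ∀ x, mul one x = x
  mul_one : ∀ x, mul x one = x
  ld_mul : ∀ x y, ld x (mul x y) = y
  mul_ld : ∀ x y, mul x (ld x y) = y
  rd_mul : ∀ x y, rd (mul x y) y = x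
  mul_rd : ∀ x y, mul (rd x y) y = x

namespace LoopStr

variable {Q : Type*}

/-- The associator `[x,y,z] = (x·(y·z)) \ ((x·y)·z)`. -/
def assoc (L : LoopStr Q) (x y z : Q) : Q :=
  L.ld (L.mul x (L.mul y z)) (L.mul (L.mul x y) z)

/-- The commutator `[x,y] = (y·x) \ (x·y)`. -/
def comm (L : LoopStr Q) (x y : Q) : Q :=
  L.ld (L.mul y x) (L.mul x y)

/-- `T(u,x) = x \ (u·x)`. -/
def Tm (L : LoopStr Q) (u x : Q) : Q := L.ld x (L.mul u x)

/-- `L(u,x,y) = (y·x) \ (y·(x·u))`. -/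
def Lm (L : LoopStr Q) (u x y : Q) : Q :=
  L.ld (L.mul y x) (L.mul y (L.mul x u))

/-- `R(u,x,y) = ((u·x)·y) / (x·y)`. -/
def Rm (L : LoopStr Q) (u x y : Q) : Q :=
  L.rd (L.mul (L.mul u x) y) (L.mul x y)

/-- The six AIM identities: the inner mapping generators commute. -/
def IsAIM (L : LoopStr Q) : Prop :=
  (∀ u x y, L.Tm (L.Tm u x) y = L.Tm (L.Tm u y) x) ∧
  (∀ u x y z w, L.Lm (L.Lm u x y) z w = L.Lm (L.Lm u z w) x y) ∧
  (∀ u x y z w, L.Rm (L.Rm u x y) z w = L.Rm (L.Rm u z w) x y) ∧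
  (∀ u x y z, L.Tm (L.Lm u x y) z = L.Lm (L.Tm u z) x y) ∧
  (∀ u x y z, L.Tm (L.Rm u x y) z = L.Rm (L.Tm u z) x y) ∧
  (∀ u x y z w, L.Lm (L.Rm u x y) z w = L.Rm (L.Lm u z w) x y)

/-- Membership in the nucleus `N(Q)`. -/
def inNucleus (L : LoopStr Q) (a : Q) : Prop :=
  (∀ x y, L.mul (L.mul a x) y = L.mul a (L.mul x y)) ∧
  (∀ x y, L.mul (L.mul x a) y = L.mul x (L.mul a y)) ∧
  (∀ x y, L.mul (L.mul x y) a = L.mul x (L.mul y a))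

/-- Membership in the center `Z(Q) = C(Q) ∩ N(Q)`. -/
def inCenter (L : LoopStr Q) (a : Q) : Prop :=
  (∀ x, L.mul a x = L.mul x a) ∧ L.inNucleus a

end LoopStr

namespace LoopStr

variable {Q : Type*} (L : LoopStr Q)

theorem mul_right_cancel {x y z : Q} (h : L.mul x z = L.mul y z) : x = y := by
  rw [← L.rd_mul x z, h, L.rd_mul]

theorem mul_Tm (u x : Q) : L.mul x (L.Tm u x) = L.mul u x := L.mul_ld _ _

theorem Tm_injective {u v x : Q} (h : L.Tm u x = L.Tm v x) : u = v :=
  L.mul_right_cancel (by rw [← L.mul_Tm, h, L.mul_Tm])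

/-- `R(·,x,y)` fixes `u` iff `u`, `x`, `y` associate in this order. -/
theorem Rm_eq_self_iff {u x y : Q} :
    L.Rm u x y = u ↔ L.mul (L.mul u x) y = L.mul u (L.mul x y) := by
  constructor
  · intro h
    rw [← L.mul_rd (L.mul (L.mul u x) y) (L.mul x y)]
    exact congrArg (fun w => L.mul w (L.mul x y)) h
  · intro h
    rw [Rm, h, L.rd_mul]

/-- `L(·,x,y)` fixes `u` iff `y`, `x`, `u` associate in this order. -/
theorem Lm_eq_self_iff {u x y : Q} :
    L.Lm u x y = u ↔ L.mul (L.mul y x) u = L.mul y (L.mul x u) := by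
  constructor
  · intro h
    rw [← L.mul_ld (L.mul y x) (L.mul y (L.mul x u))]
    exact congrArg (L.mul (L.mul y x)) h.symm
  · intro h
    rw [Lm, ← h, L.ld_mul]

theorem inNucleus_mul {L : LoopStr Q} {a b : Q} (ha : L.inNucleus a) (hb : L.inNucleus b) :
    L.inNucleus (L.mul a b) := by
  obtain ⟨ha₁, ha₂, ha₃⟩ := ha
  obtain ⟨hb₁, hb₂, hb₃⟩ := hb
  refine ⟨fun x y => ?_, fun x y => ?_, fun x y => ?_⟩
  · rw [ha₁, ha₁, ha₁, hb₁]
  · rw [← hb₃, hb₂, ha₂, ha₁]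
  · rw [← hb₃, ha₃, hb₃, hb₃]

/-- A left and right nuclear element that commutes with everything is nuclear. -/
theorem inNucleus_of_commute {L : LoopStr Q} {c : Q} (hc : ∀ x, L.mul c x = L.mul x c)
    (hl : ∀ x y, L.mul (L.mul c x) y = L.mul c (L.mul x y))
    (hr : ∀ x y, L.mul (L.mul x y) c = L.mul x (L.mul y c)) : L.inNucleus c :=
  ⟨hl, fun x y => by rw [← hc x, hl, hc (L.mul x y), hr, hc y], hr⟩

/-- If `c` is right nuclear, `d` is left nuclear, `x·c = d·x`, and
`v·(x·c) = (x·c)·T(v,x)` for all `v`, then `c` commutes with everything. -/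
theorem commute_of_Tm_eq {L : LoopStr Q} {c d x : Q}
    (hr : ∀ y z, L.mul (L.mul y z) c = L.mul y (L.mul z c))
    (hl : ∀ y z, L.mul (L.mul d y) z = L.mul d (L.mul y z))
    (hcd : L.mul x c = L.mul d x)
    (hT : ∀ v, L.mul v (L.mul x c) = L.mul (L.mul x c) (L.Tm v x)) (w : Q) :
    L.mul c w = L.mul w c := by
  have key (w : Q) : L.mul w c = L.mul d w := by
    obtain ⟨v, rfl⟩ : ∃ v, L.mul v x = w := ⟨L.rd w x, L.mul_rd w x⟩
    rw [hr, hT, hcd, hl, mul_Tm]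
  have h : c = d := by simpa only [L.one_mul, L.mul_one] using key L.one
  rw [key, ← h]

namespace IsAIM

variable {L}

/-- Conjugation by a nuclear element `a` is an automorphism commuting with `T(·,x)`, so
conjugating `x` by `a` does not change `T(·,x)`. -/
theorem mul_conj_eq_conj_mul_Tm (hAIM : L.IsAIM) {a : Q} (ha : L.inNucleus a) (x v : Q) :
    L.mul v (L.rd (L.mul a x) a) = L.mul (L.rd (L.mul a x) a) (L.Tm v x) := by
  obtain ⟨ha₁, ha₂, ha₃⟩ := ha
  have hφ (u w : Q) : L.rd (L.mul a (L.mul u w)) a =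
      L.mul (L.rd (L.mul a u) a) (L.rd (L.mul a w) a) :=
    L.mul_right_cancel (z := a) (by rw [L.mul_rd, ha₃, L.mul_rd, ← ha₂, L.mul_rd, ha₁])
  have hTa (u : Q) : L.Tm (L.rd (L.mul a u) a) a = u := by
    rw [Tm, L.mul_rd, L.ld_mul]
  have hcomm (u : Q) : L.Tm (L.rd (L.mul a u) a) x = L.rd (L.mul a (L.Tm u x)) a :=
    L.Tm_injective (x := a) (by rw [hAIM.1, hTa, hTa])
  obtain ⟨u, rfl⟩ : ∃ u, L.rd (L.mul a u) a = v :=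
    ⟨L.ld a (L.mul v a), by rw [L.mul_ld, L.rd_mul]⟩
  rw [hcomm, ← hφ, ← hφ, mul_Tm]

theorem Tm_left_nuclear (hAIM : L.IsAIM) {a : Q} (ha : L.inNucleus a) (x y z : Q) :
    L.mul (L.mul (L.Tm a x) y) z = L.mul (L.Tm a x) (L.mul y z) := by
  rw [← Rm_eq_self_iff, ← hAIM.2.2.2.2.1, L.Rm_eq_self_iff.2 (ha.1 y z)]

theorem Tm_right_nuclear (hAIM : L.IsAIM) {a : Q} (ha : L.inNucleus a) (x y z : Q) :
    L.mul (L.mul y z) (L.Tm a x) = L.mul y (L.mul z (L.Tm a x)) := by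
  rw [← Lm_eq_self_iff, ← hAIM.2.2.2.1, L.Lm_eq_self_iff.2 (ha.2.2 y z)]

theorem inNucleus_Tm (hAIM : L.IsAIM) {a : Q} (ha : L.inNucleus a) (x : Q) :
    L.inNucleus (L.Tm a x) := by
  have hbl := hAIM.Tm_left_nuclear ha x
  have hbr := hAIM.Tm_right_nuclear ha x
  have hconj := hAIM.mul_conj_eq_conj_mul_Tm ha x
  have hN := ha
  obtain ⟨ha₁, ha₂, ha₃⟩ := ha
  have hxb := L.mul_Tm a x
  obtain ⟨c, hc⟩ : ∃ c, L.mul c a = L.Tm a x := ⟨L.rd (L.Tm a x) a, L.mul_rd _ _⟩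
  rw [← hc] at hbl hbr hxb ⊢
  have hxc : L.mul x c = L.rd (L.mul a x) a := by rw [← hxb, ← ha₃, L.rd_mul]
  have hcl (y z : Q) : L.mul (L.mul c y) z = L.mul c (L.mul y z) := by
    obtain ⟨u, rfl⟩ : ∃ u, L.mul a u = y := ⟨L.ld a y, L.mul_ld _ _⟩
    rw [← ha₂, hbl, ha₂, ha₁]
  have hcr (y z : Q) : L.mul (L.mul y z) c = L.mul y (L.mul z c) :=
    L.mul_right_cancel (z := a) (by rw [ha₃, hbr, ← ha₃ z, ← ha₃])
  obtain ⟨d, hd⟩ : ∃ d, L.mul d x = L.mul x c := ⟨L.rd (L.mul x c) x, L.mul_rd _ _⟩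
  have hTd : L.Tm d x = c := by rw [Tm, hd, L.ld_mul]
  have hdl (y z : Q) : L.mul (L.mul d y) z = L.mul d (L.mul y z) := by
    refine L.Rm_eq_self_iff.1 (L.Tm_injective (x := x) ?_)
    rw [hAIM.2.2.2.2.1, hTd, L.Rm_eq_self_iff.2 (hcl y z)]
  rw [← hxc] at hconj
  exact inNucleus_mul
    (inNucleus_of_commute (commute_of_Tm_eq hcr hdl hd.symm hconj) hcl hcr) hN

end IsAIM

end LoopStr

/-- In an AIM loop, the inner mapping generators map the nucleus into itself. -/
theorem aim_nucleus_invariant {Q : Type*} (L : LoopStr Q)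
    (hAIM : L.IsAIM) (a : Q) (ha : L.inNucleus a) :
    ∀ x y,
      L.inNucleus (L.Tm a x) ∧
      L.inNucleus (L.Lm a x y) ∧
      L.inNucleus (L.Rm a x y) := by
  intro x y
  refine ⟨hAIM.inNucleus_Tm ha x, ?_, ?_⟩
  · rwa [L.Lm_eq_self_iff.2 (ha.2.2 y x)]
  · rwa [L.Rm_eq_self_iff.2 (ha.1 x y)]
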